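/- arXiv:1612.04764 — 3 statements merged into one kernel-verified Lean document; each statement's English description precedes it below -/
import Mathlib

section
/- Let n ≥ 0 and let (A^{•,•}, ∂, ∂̄) be a bounded double complex of finite-dimensional vector spaces over ℂ equipped with a real structure, such that A^{p,q} = 0 unless 0 ≤ p ≤ n and 0 ≤ q ≤ n. Then the ∂∂̄-lemma holds if and only if for every k ∈ ℤ one has Σ_{p+q=k} ( dim_ℂ H_BC^{p,q} − dim_ℂ H_A^{p,q} ) = 0, i.e. if and only if for every k the total Bott-Chern and Aeppli dimensions in degree k coincide. (Angella–Tardini's characterization of the ∂∂̄-lemma by the equality of Bott-Chern and Aeppli numbers.) -/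
open LinearMap Submodule Module DirectSum

namespace Paper

section DoubleComplex

variable (K : Type) [Field K]
variable (A : ℤ → ℤ → Type) [∀ p q, AddCommGroup (A p q)] [∀ p q, Module K (A p q)]

/-- Transport along equalities of the indices. -/
def dcCast {p q p' q' : ℤ} (h1 : p = p') (h2 : q = q') : A p q ≃ₗ[K] A p' q' := by
  subst h1; subst h2; exact LinearEquiv.refl K (A p q)

variable (d1 : ∀ p q : ℤ, A p q →ₗ[K] A (p + 1) q)
variable (d2 : ∀ p q : ℤ, A p q →ₗ[K] A p (q + 1))

/-- The operator ∂∂̄ : A^{p,q} → A^{p+1,q+1} (apply ∂̄ first, then ∂). -/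
def ddBar (p q : ℤ) : A p q →ₗ[K] A (p + 1) (q + 1) := (d1 p (q + 1)).comp (d2 p q)

/-- The image ∂∂̄(A^{p-1,q-1}) inside A^{p,q}. -/
def ddBarIm (p q : ℤ) : Submodule K (A p q) :=
  range ((dcCast K A (show p - 1 + 1 = p by ring) (show q - 1 + 1 = q by ring)).toLinearMap.comp
    (ddBar K A d1 d2 (p - 1) (q - 1)))

/-- Bott-Chern cohomology H_BC^{p,q} = (ker ∂ ∩ ker ∂̄)/∂∂̄(A^{p-1,q-1}). -/
abbrev HBC (p q : ℤ) :=
  ↥(ker (d1 p q) ⊓ ker (d2 p q)) ⧸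
    ((ddBarIm K A d1 d2 p q).comap (ker (d1 p q) ⊓ ker (d2 p q)).subtype)

noncomputable def hBC (p q : ℤ) : ℕ := finrank K (HBC K A d1 d2 p q)

/-- ∂(A^{p-1,q}) + ∂̄(A^{p,q-1}) inside A^{p,q}. -/
def aDen (p q : ℤ) : Submodule K (A p q) :=
  range ((dcCast K A (show p - 1 + 1 = p by ring) rfl).toLinearMap.comp (d1 (p - 1) q)) ⊔
  range ((dcCast K A rfl (show q - 1 + 1 = q by ring)).toLinearMap.comp (d2 p (q - 1)))

/-- Aeppli cohomology H_A^{p,q} = ker ∂∂̄ / (im ∂ + im ∂̄). -/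
abbrev HA (p q : ℤ) :=
  ↥(ker (ddBar K A d1 d2 p q)) ⧸ ((aDen K A d1 d2 p q).comap (ker (ddBar K A d1 d2 p q)).subtype)

noncomputable def hA (p q : ℤ) : ℕ := finrank K (HA K A d1 d2 p q)

/-- Column (Dolbeault) cohomology H_∂̄^{p,q}. -/
abbrev HDolb (p q : ℤ) :=
  ↥(ker (d2 p q)) ⧸
    ((range ((dcCast K A rfl (show q - 1 + 1 = q by ring)).toLinearMap.comp (d2 p (q - 1)))).comap
      (ker (d2 p q)).subtype)

noncomputable def hDolb (p q : ℤ) : ℕ := finrank K (HDolb K A d2 p q)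

/-- Row cohomology H_∂^{p,q}. -/
abbrev HRow (p q : ℤ) :=
  ↥(ker (d1 p q)) ⧸
    ((range ((dcCast K A (show p - 1 + 1 = p by ring) rfl).toLinearMap.comp (d1 (p - 1) q))).comap
      (ker (d1 p q)).subtype)

noncomputable def hRow (p q : ℤ) : ℕ := finrank K (HRow K A d1 p q)

/-- Total complex Tot^k = ⊕_{p+q=k} A^{p,q}. -/
abbrev Tot (k : ℤ) := ⨁ p : ℤ, A p (k - p)

/-- Total differential d = ∂ + ∂̄ on the total complex. -/
noncomputable def totD (k : ℤ) : Tot A k →ₗ[K] Tot A (k + 1) :=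
  DirectSum.toModule K ℤ (Tot A (k + 1)) fun p =>
    ((DirectSum.lof K ℤ (fun p' => A p' (k + 1 - p')) (p + 1)).comp
      ((dcCast K A rfl (show k - p = k + 1 - (p + 1) by ring)).toLinearMap.comp (d1 p (k - p))))
    +
    ((DirectSum.lof K ℤ (fun p' => A p' (k + 1 - p')) p).comp
      ((dcCast K A rfl (show k - p + 1 = k + 1 - p by ring)).toLinearMap.comp (d2 p (k - p))))

def totCast {k k' : ℤ} (h : k = k') : Tot A k ≃ₗ[K] Tot A k' := by
  subst h; exact LinearEquiv.refl K (Tot A k)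

/-- b_k = dim H^k(Tot, d). -/
noncomputable def bNum (k : ℤ) : ℕ :=
  finrank K
    (↥(ker (totD K A d1 d2 k)) ⧸
      ((range ((totCast K A (show k - 1 + 1 = k by ring)).toLinearMap.comp
        (totD K A d1 d2 (k - 1)))).comap (ker (totD K A d1 d2 k)).subtype))

/-- The ∂∂̄-lemma: ker ∂ ∩ ker ∂̄ ∩ (im ∂ + im ∂̄) ⊆ im ∂∂̄ in each bidegree. -/
def DDbarLemma : Prop :=
  ∀ p q : ℤ, (ker (d1 p q) ⊓ ker (d2 p q)) ⊓ aDen K A d1 d2 p q ≤ ddBarIm K A d1 d2 p q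

end DoubleComplex

/-- The map between sub-quotients induced by the identity. -/
def qMap (K : Type) [Field K] {V : Type} [AddCommGroup V] [Module K V]
    {N1 N2 M1 M2 : Submodule K V} (hN : N1 ≤ N2) (hM : M1 ≤ M2) :
    (↥N1 ⧸ M1.comap N1.subtype) →ₗ[K] (↥N2 ⧸ M2.comap N2.subtype) :=
  Submodule.mapQ _ _ (Submodule.inclusion hN) (by
    intro x hx
    simp only [Submodule.mem_comap, Submodule.coe_subtype] at hx ⊢
    simpa using hM hx)

section SComplex

variable (K : Type) [Field K]
variable (A : ℤ → Type) [∀ k, AddCommGroup (A k)] [∀ k, Module K (A k)]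

def sCast {k k' : ℤ} (h : k = k') : A k ≃ₗ[K] A k' := by
  subst h; exact LinearEquiv.refl K (A k)

variable (d : ∀ k : ℤ, A k →ₗ[K] A (k + 1))
variable (dl : ∀ k : ℤ, A k →ₗ[K] A (k - 1))

/-- The degree-0 operator dδ : A^k → A^k (apply δ first, then d). -/
def dDelta (k : ℤ) : A k →ₗ[K] A k :=
  (sCast K A (show k - 1 + 1 = k by ring)).toLinearMap.comp ((d (k - 1)).comp (dl k))

/-- Symplectic-type Bott-Chern cohomology H_BC^k = (ker d ∩ ker δ)/dδ(A^k). -/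
abbrev HBCs (k : ℤ) :=
  ↥(ker (d k) ⊓ ker (dl k)) ⧸
    ((range (dDelta K A d dl k)).comap (ker (d k) ⊓ ker (dl k)).subtype)

noncomputable def hBCs (k : ℤ) : ℕ := finrank K (HBCs K A d dl k)

/-- d(A^{k-1}) + δ(A^{k+1}) inside A^k. -/
def sDen (k : ℤ) : Submodule K (A k) :=
  range ((sCast K A (show k - 1 + 1 = k by ring)).toLinearMap.comp (d (k - 1))) ⊔
  range ((sCast K A (show k + 1 - 1 = k by ring)).toLinearMap.comp (dl (k + 1)))

/-- Symplectic-type Aeppli cohomology H_A^k = ker dδ / (im d + im δ). -/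
abbrev HAs (k : ℤ) :=
  ↥(ker (dDelta K A d dl k)) ⧸ ((sDen K A d dl k).comap (ker (dDelta K A d dl k)).subtype)

noncomputable def hAs (k : ℤ) : ℕ := finrank K (HAs K A d dl k)

/-- H_d^k = ker d / im d. -/
abbrev Hds (k : ℤ) :=
  ↥(ker (d k)) ⧸
    ((range ((sCast K A (show k - 1 + 1 = k by ring)).toLinearMap.comp (d (k - 1)))).comap
      (ker (d k)).subtype)

noncomputable def hds (k : ℤ) : ℕ := finrank K (Hds K A d k)

/-- H_δ^k = ker δ / im δ. -/
abbrev Hdls (k : ℤ) :=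
  ↥(ker (dl k)) ⧸
    ((range ((sCast K A (show k + 1 - 1 = k by ring)).toLinearMap.comp (dl (k + 1)))).comap
      (ker (dl k)).subtype)

noncomputable def hdls (k : ℤ) : ℕ := finrank K (Hdls K A dl k)

/-- The dδ-lemma: ker d ∩ ker δ ∩ (im d + im δ) ⊆ im dδ in each degree. -/
def DDeltaLemma : Prop :=
  ∀ k : ℤ, (ker (d k) ⊓ ker (dl k)) ⊓ sDen K A d dl k ≤ range (dDelta K A d dl k)

/-- The strip double complex B^{p,q} = A^{p-q}. -/
abbrev strip (p q : ℤ) := A (p - q)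

/-- ∂ on the strip double complex, given by d. -/
def stripD1 (p q : ℤ) : strip A p q →ₗ[K] strip A (p + 1) q :=
  (sCast K A (show p - q + 1 = p + 1 - q by ring)).toLinearMap.comp (d (p - q))

/-- ∂̄ on the strip double complex, given by δ. -/
def stripD2 (p q : ℤ) : strip A p q →ₗ[K] strip A p (q + 1) :=
  (sCast K A (show p - q - 1 = p - (q + 1) by ring)).toLinearMap.comp (dl (p - q))

end SComplex

section SubQuotient

variable {K V : Type} [Field K] [AddCommGroup V] [Module K V] {N1 N2 M1 M2 : Submodule K V}

theorem qMap_mk (hN : N1 ≤ N2) (hM : M1 ≤ M2) (x : N1) :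
    qMap K hN hM (Submodule.Quotient.mk x) = Submodule.Quotient.mk (Submodule.inclusion hN x) :=
  rfl

theorem qMap_injective (hN : N1 ≤ N2) (hM : M1 ≤ M2) (h : N1 ⊓ M2 ≤ M1) :
    Function.Injective (qMap K hN hM) := by
  rw [injective_iff_map_eq_zero]
  intro a
  induction a using Submodule.Quotient.induction_on with
  | H x =>
    rw [qMap_mk, Submodule.Quotient.mk_eq_zero, Submodule.Quotient.mk_eq_zero]
    exact fun hx => h ⟨x.2, hx⟩

theorem qMap_surjective_iff (hN : N1 ≤ N2) (hM : M1 ≤ M2) :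
    Function.Surjective (qMap K hN hM) ↔ N2 ≤ N1 ⊔ M2 := by
  constructor
  · intro h x hx
    obtain ⟨a, ha⟩ := h (Submodule.Quotient.mk ⟨x, hx⟩)
    induction a using Submodule.Quotient.induction_on with
    | H u =>
      rw [qMap_mk, Submodule.Quotient.eq] at ha
      have hm : (u : V) - x ∈ M2 := ha
      exact Submodule.mem_sup.2 ⟨u, u.2, -(u - x), neg_mem hm, by abel⟩
  · intro h a
    induction a using Submodule.Quotient.induction_on with
    | H x =>
      obtain ⟨u, hu, m, hm, hx⟩ := Submodule.mem_sup.1 (h x.2)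
      refine ⟨Submodule.Quotient.mk ⟨u, hu⟩, ?_⟩
      rw [qMap_mk, Submodule.Quotient.eq]
      change u - (x : V) ∈ M2
      rw [← hx, sub_add_cancel_left]
      exact neg_mem hm

end SubQuotient

section DoubleComplex

variable {K : Type} [Field K]
variable {A : ℤ → ℤ → Type} [∀ p q, AddCommGroup (A p q)] [∀ p q, Module K (A p q)]
variable {d1 : ∀ p q : ℤ, A p q →ₗ[K] A (p + 1) q}
variable {d2 : ∀ p q : ℤ, A p q →ₗ[K] A p (q + 1)}

theorem mem_ddBarIm_succ {p q : ℤ} {z : A (p + 1) (q + 1)} :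
    z ∈ ddBarIm K A d1 d2 (p + 1) (q + 1) ↔ ∃ x : A p q, d1 p (q + 1) (d2 p q x) = z := by
  have key : ∀ (r s : ℤ) (hr : r = p) (hs : s = q) (hr' : r + 1 = p + 1) (hs' : s + 1 = q + 1),
      range ((dcCast K A hr' hs').toLinearMap.comp (ddBar K A d1 d2 r s)) =
        range (ddBar K A d1 d2 p q) := by
    rintro r s rfl rfl _ _
    rfl
  rw [ddBarIm, key _ _ (by ring) (by ring)]
  rfl

theorem mem_aDen_succ {p q : ℤ} {z : A (p + 1) (q + 1)} :
    z ∈ aDen K A d1 d2 (p + 1) (q + 1) ↔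
      ∃ (x : A p (q + 1)) (y : A (p + 1) q), d1 p (q + 1) x + d2 (p + 1) q y = z := by
  have key1 : ∀ (r : ℤ) (hr : r = p) (hr' : r + 1 = p + 1),
      range ((dcCast K A hr' rfl).toLinearMap.comp (d1 r (q + 1))) = range (d1 p (q + 1)) := by
    rintro r rfl _
    rfl
  have key2 : ∀ (s : ℤ) (hs : s = q) (hs' : s + 1 = q + 1),
      range ((dcCast K A rfl hs').toLinearMap.comp (d2 (p + 1) s)) = range (d2 (p + 1) q) := by
    rintro s rfl _
    rfl
  rw [aDen, key1 _ (by ring), key2 _ (by ring), Submodule.mem_sup]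
  simp

theorem forall_int_succ {P : ℤ → ℤ → Prop} (h : ∀ p q, P (p + 1) (q + 1)) (p q : ℤ) : P p q := by
  simpa using h (p - 1) (q - 1)

theorem ddBarIm_le_aDen (p q : ℤ) : ddBarIm K A d1 d2 p q ≤ aDen K A d1 d2 p q := by
  revert p q
  refine forall_int_succ fun p q z hz => ?_
  obtain ⟨x, rfl⟩ := mem_ddBarIm_succ.1 hz
  exact mem_aDen_succ.2 ⟨d2 p q x, 0, by simp⟩

theorem ker_inf_ker_le_ker_ddBar (p q : ℤ) :
    ker (d1 p q) ⊓ ker (d2 p q) ≤ ker (ddBar K A d1 d2 p q) := by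
  rintro x ⟨-, hx⟩
  have hx' : d2 p q x = 0 := hx
  simp [ddBar, hx']

theorem ddbar_lemma_of_coker_eq_zero
    (hd1d1 : ∀ (p q : ℤ) (x : A p q), d1 (p + 1) q (d1 p q x) = 0)
    (hd2d2 : ∀ (p q : ℤ) (x : A p q), d2 p (q + 1) (d2 p q x) = 0)
    (hanti : ∀ (p q : ℤ) (x : A p q), d1 p (q + 1) (d2 p q x) + d2 (p + 1) q (d1 p q x) = 0)
    {k : ℤ}
    (h : ∀ p q : ℤ, p + q = k → ker (ddBar K A d1 d2 p q) ≤
      (ker (d1 p q) ⊓ ker (d2 p q)) ⊔ aDen K A d1 d2 p q) (p q : ℤ) :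
    p + q = k + 1 →
      (ker (d1 p q) ⊓ ker (d2 p q)) ⊓ aDen K A d1 d2 p q ≤ ddBarIm K A d1 d2 p q := by
  revert p q
  refine forall_int_succ <| forall_int_succ fun p q hpq => ?_
  rintro z ⟨⟨hz1, hz2⟩, hz⟩
  obtain ⟨x, y, rfl⟩ := mem_aDen_succ.1 hz
  have hx : x ∈ ker (ddBar K A d1 d2 (p + 1) (q + 1 + 1)) := by
    have hdx : d2 (p + 1 + 1) (q + 1 + 1) (d1 (p + 1) (q + 1 + 1) x) = 0 := by
      simpa [hd2d2] using hz2
    simpa [hdx, ddBar] using hanti (p + 1) (q + 1 + 1) x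
  have hy : y ∈ ker (ddBar K A d1 d2 (p + 1 + 1) (q + 1)) := by
    simpa [hd1d1, ddBar] using hz1
  obtain ⟨u, ⟨hu, -⟩, w, hw, rfl⟩ := Submodule.mem_sup.1 (h _ _ (by omega) hx)
  obtain ⟨v, ⟨-, hv⟩, t, ht, rfl⟩ := Submodule.mem_sup.1 (h _ _ (by omega) hy)
  obtain ⟨a, b, rfl⟩ := mem_aDen_succ.1 hw
  obtain ⟨a', b', rfl⟩ := mem_aDen_succ.1 ht
  refine mem_ddBarIm_succ.2 ⟨b - a', ?_⟩
  have hu' : d1 (p + 1) (q + 1 + 1) u = 0 := hu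
  have hv' : d2 (p + 1 + 1) (q + 1) v = 0 := hv
  simp only [map_add, map_sub, hu', hv', hd1d1, hd2d2, zero_add, add_zero,
    eq_neg_of_add_eq_zero_right (hanti (p + 1) (q + 1) a')]
  abel

theorem coker_eq_zero_of_ddbar_lemma
    (hd1d1 : ∀ (p q : ℤ) (x : A p q), d1 (p + 1) q (d1 p q x) = 0)
    (hd2d2 : ∀ (p q : ℤ) (x : A p q), d2 p (q + 1) (d2 p q x) = 0)
    (hanti : ∀ (p q : ℤ) (x : A p q), d1 p (q + 1) (d2 p q x) + d2 (p + 1) q (d1 p q x) = 0)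
    (h : DDbarLemma K A d1 d2) (p q : ℤ) :
    ker (ddBar K A d1 d2 p q) ≤ (ker (d1 p q) ⊓ ker (d2 p q)) ⊔ aDen K A d1 d2 p q := by
  revert p q
  refine forall_int_succ fun p q x hx => ?_
  have hx1 : d1 (p + 1) (q + 1 + 1) (d2 (p + 1) (q + 1) x) = 0 := hx
  have hx2 : d2 (p + 1 + 1) (q + 1) (d1 (p + 1) (q + 1) x) = 0 := by
    simpa [hx1] using hanti (p + 1) (q + 1) x
  obtain ⟨a, ha⟩ := mem_ddBarIm_succ.1 <| h (p + 1 + 1) (q + 1)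
    ⟨⟨hd1d1 _ _ x, hx2⟩, mem_aDen_succ.2 ⟨x, 0, by simp⟩⟩
  obtain ⟨b, hb⟩ := mem_ddBarIm_succ.1 <| h (p + 1) (q + 1 + 1)
    ⟨⟨hx1, hd2d2 _ _ x⟩, mem_aDen_succ.2 ⟨0, x, by simp⟩⟩
  refine Submodule.mem_sup.2 ⟨x - d2 (p + 1) q a + d1 p (q + 1) b, ⟨?_, ?_⟩,
    d2 (p + 1) q a - d1 p (q + 1) b, mem_aDen_succ.2 ⟨-b, a, ?_⟩, by abel⟩
  · simp [ha, hd1d1]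
  · simp [← hb, hd2d2, eq_neg_of_add_eq_zero_right (hanti p (q + 1) b)]
  · rw [map_neg]
    abel

end DoubleComplex

theorem ddbar_lemma_iff_BC_eq_A (n : ℕ)
    (A : ℤ → ℤ → Type) [∀ p q, AddCommGroup (A p q)] [∀ p q, Module ℂ (A p q)]
    [∀ p q, FiniteDimensional ℂ (A p q)]
    (d1 : ∀ p q : ℤ, A p q →ₗ[ℂ] A (p + 1) q)
    (d2 : ∀ p q : ℤ, A p q →ₗ[ℂ] A p (q + 1))
    (hsupp : ∀ p q : ℤ, (p < 0 ∨ (n : ℤ) < p ∨ q < 0 ∨ (n : ℤ) < q) → Subsingleton (A p q))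
    (hd1d1 : ∀ (p q : ℤ) (x : A p q), d1 (p + 1) q (d1 p q x) = 0)
    (hd2d2 : ∀ (p q : ℤ) (x : A p q), d2 p (q + 1) (d2 p q x) = 0)
    (hanti : ∀ (p q : ℤ) (x : A p q), d1 p (q + 1) (d2 p q x) + d2 (p + 1) q (d1 p q x) = 0)
    (σ : ∀ p q : ℤ, A p q →ₛₗ[starRingEnd ℂ] A q p)
    (hσσ : ∀ (p q : ℤ) (x : A p q), σ q p (σ p q x) = x)
    (hσd : ∀ (p q : ℤ) (x : A p q), σ (p + 1) q (d1 p q x) = d2 q p (σ p q x)) :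
    DDbarLemma ℂ A d1 d2 ↔
      ∀ k : ℤ,
        ∑ᶠ p : ℤ, ((hBC ℂ A d1 d2 p (k - p) : ℤ) - (hA ℂ A d1 d2 p (k - p) : ℤ)) = 0 := by
  have hBC_le (p q : ℤ) :
      (ker (d1 p q) ⊓ ker (d2 p q)) ⊓ aDen ℂ A d1 d2 p q ≤ ddBarIm ℂ A d1 d2 p q →
        hBC ℂ A d1 d2 p q ≤ hA ℂ A d1 d2 p q := fun h =>
    LinearMap.finrank_le_finrank_of_injective
      (qMap_injective (ker_inf_ker_le_ker_ddBar p q) (ddBarIm_le_aDen p q) h)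
  have hsurj (p q : ℤ) := qMap_surjective_iff
    (ker_inf_ker_le_ker_ddBar (d1 := d1) (d2 := d2) p q)
    (ddBarIm_le_aDen (d1 := d1) (d2 := d2) p q)
  constructor
  · intro h k
    refine finsum_eq_zero_of_forall_eq_zero fun p => ?_
    have hge : hA ℂ A d1 d2 p (k - p) ≤ hBC ℂ A d1 d2 p (k - p) :=
      LinearMap.finrank_le_finrank_of_surjective <| (hsurj _ _).2 <|
        coker_eq_zero_of_ddbar_lemma hd1d1 hd2d2 hanti h _ _
    have hle := hBC_le _ _ (h p (k - p))
    omega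
  · intro h
    have hneg (p q : ℤ) (hpq : p + q < 0) :
        (ker (d1 p q) ⊓ ker (d2 p q)) ⊓ aDen ℂ A d1 d2 p q ≤ ddBarIm ℂ A d1 d2 p q := by
      have := hsupp p q (by omega)
      exact (Subsingleton.elim _ _).le
    have hstep (k : ℤ) (hk : ∀ p q : ℤ, p + q = k →
        (ker (d1 p q) ⊓ ker (d2 p q)) ⊓ aDen ℂ A d1 d2 p q ≤ ddBarIm ℂ A d1 d2 p q) (p q : ℤ) :
        p + q = k + 1 →
          (ker (d1 p q) ⊓ ker (d2 p q)) ⊓ aDen ℂ A d1 d2 p q ≤ ddBarIm ℂ A d1 d2 p q := by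
      refine ddbar_lemma_of_coker_eq_zero hd1d1 hd2d2 hanti (fun p q hpq => ?_) p q
      have hterm (p : ℤ) : 0 ≤ (hA ℂ A d1 d2 p (k - p) : ℤ) - hBC ℂ A d1 d2 p (k - p) := by
        have := hBC_le _ _ (hk p (k - p) (by ring))
        omega
      have hfin : (Function.support fun p : ℤ =>
          (hA ℂ A d1 d2 p (k - p) : ℤ) - hBC ℂ A d1 d2 p (k - p)).Finite := by
        refine (Set.finite_Icc 0 (n : ℤ)).subset fun p hp => ?_
        by_contra hmem
        have := hsupp p (k - p) (by rw [Set.mem_Icc] at hmem; omega)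
        refine hp ?_
        simp [hA, hBC, finrank_zero_of_subsingleton]
      have hsum : ∑ᶠ p : ℤ, ((hA ℂ A d1 d2 p (k - p) : ℤ) - hBC ℂ A d1 d2 p (k - p)) = 0 := by
        rw [← neg_eq_zero, ← finsum_neg_distrib]
        simpa using h k
      obtain rfl : q = k - p := by omega
      have hp : (hA ℂ A d1 d2 p (k - p) : ℤ) - hBC ℂ A d1 d2 p (k - p) = 0 :=
        le_antisymm (hsum ▸ single_le_finsum p hfin hterm) (hterm p)
      refine (hsurj _ _).1 <| (LinearMap.injective_iff_surjective_of_finrank_eq_finrank ?_).1 <|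
        qMap_injective _ _ (hk _ _ hpq)
      change hBC ℂ A d1 d2 p (k - p) = hA ℂ A d1 d2 p (k - p)
      omega
    have hnat (m : ℕ) : ∀ p q : ℤ, p + q = -1 + m →
        (ker (d1 p q) ⊓ ker (d2 p q)) ⊓ aDen ℂ A d1 d2 p q ≤ ddBarIm ℂ A d1 d2 p q := by
      induction m with
      | zero => exact fun p q hpq => hneg p q (by omega)
      | succ m ih => exact fun p q hpq => hstep _ ih p q (by push_cast at hpq; omega)
    intro p q
    by_cases hpq : p + q < 0
    · exact hneg p q hpq
    · exact hnat (p + q + 1).toNat p q (by omega)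

end Paper
end

section
/- Let (A^•, d, δ) be a bounded (d,δ)-complex of finite-dimensional vector spaces over a field K. Then for every k ∈ ℤ one has dim_K H_BC^k + dim_K H_A^k ≥ dim_K H_d^k + dim_K H_δ^k. (Algebraic form, for a graded complex with two anticommuting differentials of degrees +1 and −1 as given by d and d^Λ on a symplectic manifold, of the Angella–Tomassini Frölicher-type inequality for the Tseng–Yau symplectic Bott-Chern and Aeppli cohomologies.) -/
open LinearMap Submodule Module DirectSum

namespace Paper

theorem finrank_quotient_comap_subtype_add_finrank {K V : Type*} [Field K] [AddCommGroup V]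
    [Module K V] [FiniteDimensional K V] {M N : Submodule K V} (h : M ≤ N) :
    finrank K (↥N ⧸ M.comap N.subtype) + finrank K M = finrank K N := by
  rw [← (Submodule.comapSubtypeEquivOfLe h).finrank_eq]
  exact Submodule.finrank_quotient_add_finrank _

/-- The dimension count behind the inequality, for two pairs `B₁ ≤ Z₁` and `B₂ ≤ Z₂`. -/
theorem finrank_quotients_add_le {K V : Type*} [Field K] [AddCommGroup V]
    [Module K V] [FiniteDimensional K V] {Z₁ Z₂ B₁ B₂ I J : Submodule K V}
    (h₁ : B₁ ≤ Z₁) (h₂ : B₂ ≤ Z₂) (hI : I ≤ B₁ ⊓ B₂) (hJ : Z₁ ⊔ Z₂ ≤ J) :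
    finrank K (↥Z₁ ⧸ B₁.comap Z₁.subtype) + finrank K (↥Z₂ ⧸ B₂.comap Z₂.subtype) ≤
      finrank K (↥(Z₁ ⊓ Z₂) ⧸ I.comap (Z₁ ⊓ Z₂).subtype) +
        finrank K (↥J ⧸ (B₁ ⊔ B₂).comap J.subtype) := by
  have e₁ := finrank_quotient_comap_subtype_add_finrank h₁
  have e₂ := finrank_quotient_comap_subtype_add_finrank h₂
  have eI := finrank_quotient_comap_subtype_add_finrank (hI.trans (inf_le_inf h₁ h₂))
  have eJ := finrank_quotient_comap_subtype_add_finrank ((sup_le_sup h₁ h₂).trans hJ)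
  have eZ := Submodule.finrank_sup_add_finrank_inf_eq Z₁ Z₂
  have eB := Submodule.finrank_sup_add_finrank_inf_eq B₁ B₂
  have lI := Submodule.finrank_mono hI
  have lJ := Submodule.finrank_mono hJ
  omega

section Cast

variable {K : Type} [Field K] {A : ℤ → Type} [∀ k, AddCommGroup (A k)] [∀ k, Module K (A k)]

theorem map_sCast_eq_zero_iff {f : ℤ → ℤ} (g : ∀ k, A k →ₗ[K] A (f k)) {j k : ℤ} (h : j = k)
    (x : A j) : g k (sCast K A h x) = 0 ↔ g j x = 0 := by
  subst h; rfl

theorem sCast_sCast {i j k : ℤ} (h : i = j) (h' : j = k) (x : A i) :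
    sCast K A h' (sCast K A h x) = sCast K A (h.trans h') x := by
  subst h; subst h'; rfl

end Cast

theorem symplectic_frolicher_type_inequality (K : Type) [Field K]
    (A : ℤ → Type) [∀ k, AddCommGroup (A k)] [∀ k, Module K (A k)]
    [∀ k, FiniteDimensional K (A k)]
    (d : ∀ k : ℤ, A k →ₗ[K] A (k + 1))
    (dl : ∀ k : ℤ, A k →ₗ[K] A (k - 1))
    (hbdd : {k : ℤ | Nontrivial (A k)}.Finite)
    (hdd : ∀ (k : ℤ) (x : A k), d (k + 1) (d k x) = 0)
    (hdldl : ∀ (k : ℤ) (x : A k), dl (k - 1) (dl k x) = 0)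
    (hanti : ∀ (k : ℤ) (x : A k),
      sCast K A (show k + 1 - 1 = k - 1 + 1 by ring) (dl (k + 1) (d k x)) + d (k - 1) (dl k x) = 0) :
    ∀ k : ℤ, hds K A d k + hdls K A dl k ≤ hBCs K A d dl k + hAs K A d dl k := by
  intro k
  have hanti' (x : A k) : dDelta K A d dl k x =
      -sCast K A (show k + 1 - 1 = k by ring) (dl (k + 1) (d k x)) := by
    simp only [dDelta, LinearMap.comp_apply, LinearEquiv.coe_coe]
    rw [← neg_eq_of_add_eq_zero_right (hanti k x), map_neg, sCast_sCast]
  refine finrank_quotients_add_le ?_ ?_ (le_inf ?_ ?_) (sup_le ?_ ?_)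
  · rintro _ ⟨x, rfl⟩
    exact (map_sCast_eq_zero_iff d _ _).2 (hdd _ x)
  · rintro _ ⟨x, rfl⟩
    exact (map_sCast_eq_zero_iff dl _ _).2 (hdldl _ x)
  · rintro _ ⟨x, rfl⟩
    exact ⟨dl k x, rfl⟩
  · rintro _ ⟨x, rfl⟩
    rw [hanti']
    exact neg_mem ⟨d k x, rfl⟩
  · intro x hx
    rw [LinearMap.mem_ker] at hx ⊢
    rw [hanti', hx, map_zero, map_zero, neg_zero]
  · intro x hx
    rw [LinearMap.mem_ker] at hx ⊢
    simp [dDelta, hx]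

end Paper
end

section
/- Let n ≥ 0 and let (A^•, d, δ) be a bounded (d,δ)-complex of finite-dimensional vector spaces over a field K with A^h = 0 unless 0 ≤ h ≤ 2n, and assume dim_K H_δ^h = dim_K H_d^{2n−h} for every h (as holds for the forms of a compact symplectic 2n-manifold via the symplectic Hodge star operator). Then for each residue class k modulo 2: Σ_{h ≡ k (mod 2)} dim_K H_A^h ≤ 2(2n+1) · Σ_{h ∈ ℤ} dim_K H_d^h. (Algebraic form of the Angella–Tardini upper bound for the symplectic Aeppli numbers in terms of the Betti numbers.) -/
open LinearMap Submodule Module DirectSum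

namespace Paper

theorem finrank_quotient_comap_add {K V : Type} [Field K] [AddCommGroup V] [Module K V]
    [FiniteDimensional K V] {M N : Submodule K V} (h : M ≤ N) :
    finrank K (↥N ⧸ M.comap N.subtype) + finrank K M = finrank K N := by
  rw [← Submodule.finrank_quotient_add_finrank (M.comap N.subtype),
    (Submodule.comapSubtypeEquivOfLe h).finrank_eq]

theorem finrank_map_add_finrank_inf_ker {K V W : Type} [Field K] [AddCommGroup V] [Module K V]
    [FiniteDimensional K V] [AddCommGroup W] [Module K W] (f : V →ₗ[K] W) (N : Submodule K V) :
    finrank K (N.map f) + finrank K ↥(N ⊓ ker f) = finrank K N := by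
  have h := LinearMap.finrank_range_add_finrank_ker (f.domRestrict N)
  rw [LinearMap.range_domRestrict, LinearMap.ker_domRestrict] at h
  have hN : (N ⊓ ker f).comap N.subtype = (ker f).comap N.subtype := by
    ext x
    simp
  rw [← h, ← hN, (Submodule.comapSubtypeEquivOfLe inf_le_left).finrank_eq]

/-- One step of the zigzag estimate, for `U`, `V`, `W` in three consecutive degrees: the Aeppli
cohomology at `U` is bounded by `H_d` at `U`, `H_δ` at `V` and the Aeppli cohomology at `W`. -/
theorem finrank_aeppli_step {K U V W Y : Type} [Field K]
    [AddCommGroup U] [Module K U] [FiniteDimensional K U]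
    [AddCommGroup V] [Module K V] [FiniteDimensional K V]
    [AddCommGroup W] [Module K W] [FiniteDimensional K W]
    [AddCommGroup Y] [Module K Y]
    (d : U →ₗ[K] V) (d' : V →ₗ[K] W) (dl : V →ₗ[K] U) (dl' : W →ₗ[K] V) (e : Y →ₗ[K] W)
    (I Z : Submodule K U) (hI : I ≤ ker d) (hZ : ∀ x, x ∈ Z ↔ dl (d x) = 0)
    (hd : ∀ x, d' (d x) = 0) (hdl : ∀ x, dl (dl' x) = 0) (he : ∀ y, dl' (e y) = 0)
    (hanti : ∀ x, dl' (d' x) + d (dl x) = 0) :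
    finrank K (↥Z ⧸ (I ⊔ range dl).comap Z.subtype) ≤
      finrank K (↥(ker d) ⧸ I.comap (ker d).subtype) +
      finrank K (↥(ker dl) ⧸ (range dl').comap (ker dl).subtype) +
      finrank K (↥(ker (d'.comp dl')) ⧸
        (range d' ⊔ range e).comap (ker (d'.comp dl')).subtype) := by
  have hdl' : range dl' ≤ ker dl := by rintro _ ⟨x, rfl⟩; exact hdl x
  have hBU : I ⊔ range dl ≤ Z := by
    refine sup_le (fun x hx => ?_) ?_
    · rw [hZ, hI hx, map_zero]
    · rintro _ ⟨x, rfl⟩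
      rw [hZ, eq_neg_of_add_eq_zero_right (hanti x), map_neg, hdl, neg_zero]
  have hBW : range d' ⊔ range e ≤ ker (d'.comp dl') := by
    refine sup_le ?_ ?_
    · rintro _ ⟨x, rfl⟩
      simp [eq_neg_of_add_eq_zero_left (hanti x), hd]
    · rintro _ ⟨x, rfl⟩
      simp [he]
  have hkZ : ker d ≤ Z := fun x hx => by
    rw [hZ, LinearMap.mem_ker.1 hx, map_zero]
  have e1 := finrank_quotient_comap_add hBU
  have e2 := finrank_quotient_comap_add hI
  have e3 := finrank_quotient_comap_add hdl'
  have e4 := finrank_quotient_comap_add hBW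
  have e5 := finrank_map_add_finrank_inf_ker d Z
  rw [inf_eq_right.2 hkZ] at e5
  have e6 := finrank_map_add_finrank_inf_ker d (range dl)
  have e7 := finrank_map_add_finrank_inf_ker dl' (ker (d'.comp dl'))
  have e8 := finrank_map_add_finrank_inf_ker dl' (range d' ⊔ range e)
  have e9 := Submodule.finrank_sup_add_finrank_inf_eq (Z.map d) (range dl')
  have e10 := Submodule.finrank_sup_add_finrank_inf_eq I (range dl)
  have i1 : finrank K ↥(Z.map d ⊔ range dl') ≤ finrank K (ker dl) := by
    refine Submodule.finrank_mono (sup_le ?_ hdl')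
    rintro _ ⟨x, hx, rfl⟩
    exact (hZ x).1 hx
  have i2 : finrank K ↥(Z.map d ⊓ range dl') ≤ finrank K ((ker (d'.comp dl')).map dl') := by
    refine Submodule.finrank_mono ?_
    rintro _ ⟨⟨x, -, hx⟩, ⟨y, rfl⟩⟩
    exact ⟨y, by simp [← hx, hd], rfl⟩
  have i3 : finrank K ((range d' ⊔ range e).map dl') ≤ finrank K ((range dl).map d) := by
    refine Submodule.finrank_mono ?_
    rw [Submodule.map_sup]
    refine sup_le ?_ ?_
    · rintro _ ⟨_, ⟨x, rfl⟩, rfl⟩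
      exact ⟨-dl x, ⟨-x, map_neg _ _⟩, by
        rw [map_neg, eq_neg_of_add_eq_zero_left (hanti x)]⟩
    · rintro _ ⟨_, ⟨x, rfl⟩, rfl⟩
      rw [he]
      exact zero_mem _
  have i4 : finrank K ↥((range d' ⊔ range e) ⊓ ker dl') ≤
      finrank K ↥(ker (d'.comp dl') ⊓ ker dl') :=
    Submodule.finrank_mono (inf_le_inf_right _ hBW)
  have i5 : finrank K ↥(I ⊓ range dl) ≤ finrank K ↥(range dl ⊓ ker d) :=
    Submodule.finrank_mono (le_inf inf_le_right (inf_le_left.trans hI))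
  omega

section Cast

variable {K : Type} [Field K] {A : ℤ → Type} [∀ k, AddCommGroup (A k)] [∀ k, Module K (A k)]

theorem sCast_refl {i : ℤ} (h : i = i) (x : A i) : sCast K A h x = x := rfl

theorem map_sCast_add (d : ∀ k : ℤ, A k →ₗ[K] A (k + 1)) {i j : ℤ} (h : i = j) (x : A i) :
    d j (sCast K A h x) = sCast K A (by rw [h]) (d i x) := by
  subst h; rfl

theorem map_sCast_sub (dl : ∀ k : ℤ, A k →ₗ[K] A (k - 1)) {i j : ℤ} (h : i = j) (x : A i) :
    dl j (sCast K A h x) = sCast K A (by rw [h]) (dl i x) := by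
  subst h; rfl

variable [∀ k, FiniteDimensional K (A k)]
  (d : ∀ k : ℤ, A k →ₗ[K] A (k + 1)) (dl : ∀ k : ℤ, A k →ₗ[K] A (k - 1))

theorem hAs_le_add (hdd : ∀ (k : ℤ) (x : A k), d (k + 1) (d k x) = 0)
    (hdldl : ∀ (k : ℤ) (x : A k), dl (k - 1) (dl k x) = 0)
    (hanti : ∀ (k : ℤ) (x : A k),
      sCast K A (show k + 1 - 1 = k - 1 + 1 by ring) (dl (k + 1) (d k x)) + d (k - 1) (dl k x) = 0)
    (k : ℤ) {k' : ℤ} (hk : k' = k + 1 + 1) :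
    hAs K A d dl k ≤ hds K A d k + hdls K A dl (k + 1) + hAs K A d dl k' := by
  have hcomm : ∀ (i : ℤ) (x : A i), d (i - 1) (dl i x) =
      - sCast K A (show i + 1 - 1 = i - 1 + 1 by ring) (dl (i + 1) (d i x)) := fun i x =>
    eq_neg_of_add_eq_zero_right (hanti i x)
  have hdd' : ∀ (i j l : ℤ) (h : i + 1 = j) (h' : j + 1 = l) (x : A i),
      sCast K A h' (d j (sCast K A h (d i x))) = 0 := by
    rintro i _ _ rfl rfl x
    exact hdd i x
  have hdldl' : ∀ (i j l : ℤ) (h : i - 1 = j) (h' : j - 1 = l) (x : A i),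
      sCast K A h' (dl j (sCast K A h (dl i x))) = 0 := by
    rintro i _ _ rfl rfl x
    exact hdldl i x
  subst hk
  have hdDelta : dDelta K A d dl (k + 1 + 1) = (d (k + 1)).comp
      ((sCast K A (show k + 1 + 1 - 1 = k + 1 by ring)).toLinearMap.comp (dl (k + 1 + 1))) := by
    ext x
    simp [dDelta, map_sCast_add]
  have hrange : range ((sCast K A (show k + 1 + 1 - 1 + 1 = k + 1 + 1 by ring)).toLinearMap.comp
      (d (k + 1 + 1 - 1))) = range (d (k + 1)) := by
    have aux : ∀ (i j : ℤ) (h : i = j) (h' : i + 1 = j + 1),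
        range ((sCast K A h').toLinearMap.comp (d i)) = range (d j) := by
      rintro i _ rfl h'
      rfl
    exact aux _ _ (by ring) _
  have key := finrank_aeppli_step (K := K) (d k) (d (k + 1))
    ((sCast K A (show k + 1 - 1 = k by ring)).toLinearMap.comp (dl (k + 1)))
    ((sCast K A (show k + 1 + 1 - 1 = k + 1 by ring)).toLinearMap.comp (dl (k + 1 + 1)))
    ((sCast K A (show k + 1 + 1 + 1 - 1 = k + 1 + 1 by ring)).toLinearMap.comp
      (dl (k + 1 + 1 + 1)))
    (range ((sCast K A (show k - 1 + 1 = k by ring)).toLinearMap.comp (d (k - 1))))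
    (ker (dDelta K A d dl k)) ?_ ?_ (hdd k) ?_ ?_ ?_
  · have hker : ker ((sCast K A (show k + 1 - 1 = k by ring)).toLinearMap.comp (dl (k + 1))) =
        ker (dl (k + 1)) := LinearEquiv.ker_comp _ _
    rw [hker, ← hdDelta, ← hrange] at key
    exact key
  · rintro _ ⟨x, rfl⟩
    have := hdd' (k - 1) k (k + 1) (by ring) rfl x
    rw [sCast_refl] at this
    exact this
  · intro x
    simp [dDelta, hcomm]
  · intro x
    exact hdldl' _ _ _ _ _ _
  · intro x
    exact hdldl' _ _ _ _ _ _
  · intro x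
    have h := hcomm (k + 1) x
    simp only [LinearMap.comp_apply, LinearEquiv.coe_coe, map_sCast_add, h, map_neg, sCast_sCast]
    exact add_neg_cancel _

end Cast

theorem symplectic_A_upper_bound (n : ℕ) (K : Type) [Field K]
    (A : ℤ → Type) [∀ k, AddCommGroup (A k)] [∀ k, Module K (A k)]
    [∀ k, FiniteDimensional K (A k)]
    (d : ∀ k : ℤ, A k →ₗ[K] A (k + 1))
    (dl : ∀ k : ℤ, A k →ₗ[K] A (k - 1))
    (hsupp : ∀ h : ℤ, (h < 0 ∨ 2 * (n : ℤ) < h) → Subsingleton (A h))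
    (hdd : ∀ (k : ℤ) (x : A k), d (k + 1) (d k x) = 0)
    (hdldl : ∀ (k : ℤ) (x : A k), dl (k - 1) (dl k x) = 0)
    (hanti : ∀ (k : ℤ) (x : A k),
      sCast K A (show k + 1 - 1 = k - 1 + 1 by ring) (dl (k + 1) (d k x)) + d (k - 1) (dl k x) = 0)
    (hdual : ∀ h : ℤ, hdls K A dl h = hds K A d (2 * (n : ℤ) - h)) :
    ∀ k : ℤ,
      (∑ᶠ h : ℤ, if h % 2 = k % 2 then hAs K A d dl h else 0) ≤
        2 * (2 * n + 1) * ∑ᶠ h : ℤ, hds K A d h := by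
  intro k
  have hA0 : ∀ h : ℤ, (h < 0 ∨ 2 * (n : ℤ) < h) → hAs K A d dl h = 0 := fun h hh => by
    have := hsupp h hh
    exact finrank_zero_of_subsingleton
  have hd0 : ∀ h : ℤ, (h < 0 ∨ 2 * (n : ℤ) < h) → hds K A d h = 0 := fun h hh => by
    have := hsupp h hh
    exact finrank_zero_of_subsingleton
  have hdl0 : ∀ h : ℤ, (h < 0 ∨ 2 * (n : ℤ) < h) → hdls K A dl h = 0 := fun h hh => by
    have := hsupp h hh
    exact finrank_zero_of_subsingleton
  have htail : ∀ (m : ℕ) (h : ℤ), 2 * (n : ℤ) < h + m → hAs K A d dl h ≤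
      ∑ i ∈ Finset.Icc h (2 * n + 1), (hds K A d i + hdls K A dl i) := by
    intro m
    induction m using Nat.strong_induction_on with
    | _ m ih =>
      intro h hm
      by_cases hh : 2 * (n : ℤ) < h
      · simp [hA0 h (Or.inr hh)]
      · have hstep := hAs_le_add d dl hdd hdldl hanti h (k' := h + 1 + 1) rfl
        have hrec : hAs K A d dl (h + 1 + 1) ≤
            ∑ i ∈ Finset.Icc (h + 1 + 1) (2 * n + 1), (hds K A d i + hdls K A dl i) :=
          ih (m - 1) (by omega) (h + 1 + 1) (by omega)
        have s1 : Finset.Icc h (2 * (n : ℤ) + 1) =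
            insert h (insert (h + 1) (Finset.Icc (h + 1 + 1) (2 * n + 1))) := by
          ext i
          simp only [Finset.mem_Icc, Finset.mem_insert]
          omega
        rw [s1, Finset.sum_insert (by simp), Finset.sum_insert (by simp)]
        omega
  have hsum : ∀ f : ℤ → ℕ, (∀ h : ℤ, (h < 0 ∨ 2 * (n : ℤ) < h) → f h = 0) → ∀ N : ℤ,
      2 * (n : ℤ) ≤ N → ∑ᶠ h, f h = ∑ h ∈ Finset.Icc 0 N, f h := by
    intro f hf N hN
    refine finsum_eq_sum_of_support_subset _ fun h hh => ?_
    by_contra hc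
    refine hh (hf h ?_)
    simp only [Finset.coe_Icc, Set.mem_Icc] at hc
    omega
  have hdl_sum : ∑ᶠ h, hdls K A dl h = ∑ᶠ h, hds K A d h := by
    simp_rw [hdual]
    exact finsum_comp_equiv (Equiv.subLeft (2 * (n : ℤ)))
  have hbound : ∀ h : ℤ, 0 ≤ h → hAs K A d dl h ≤ 2 * ∑ᶠ i, hds K A d i := by
    intro h hh
    refine (htail (2 * n + 1) h (by push_cast; omega)).trans ?_
    rw [two_mul (∑ᶠ i, hds K A d i)]
    nth_rewrite 2 [← hdl_sum]
    rw [hsum _ hd0 (2 * n + 1) (by omega), hsum _ hdl0 (2 * n + 1) (by omega),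
      ← Finset.sum_add_distrib]
    exact Finset.sum_le_sum_of_subset (Finset.Icc_subset_Icc_left hh)
  rw [hsum (fun h => if h % 2 = k % 2 then hAs K A d dl h else 0)
    (fun h hh => by simp [hA0 h hh]) (2 * n) le_rfl]
  refine (Finset.sum_le_card_nsmul _ _ (2 * ∑ᶠ i, hds K A d i) fun h hh => ?_).trans ?_
  · split_ifs
    · exact hbound h (Finset.mem_Icc.1 hh).1
    · exact Nat.zero_le _
  · have hcard : (Finset.Icc (0 : ℤ) (2 * n)).card = 2 * n + 1 := by
      rw [Int.card_Icc]
      omega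
    rw [hcard, smul_eq_mul]
    exact le_of_eq (by ring)

end Paper
end
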